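/- arXiv:1301.4692 — 2 statements merged into one kernel-verified Lean document; each statement's English description precedes it below -/
import Mathlib

section
/- Let L be a domain and let E be a locally compact quasisober topological space. Every L-valued maxitive measure on the Borel σ-algebra ℬ of E that is 𝒬-smooth, 𝓕-smooth, and saturated is tight and weakly outer-continuous. -/
open Set

universe u v

section OrderDefs
variable {L : Type u} [PartialOrder L]

/-- A filtered (nonempty, downward directed) subset of a poset. -/
def DirFiltered (F : Set L) : Prop :=
  F.Nonempty ∧ ∀ r ∈ F, ∀ s ∈ F, ∃ t ∈ F, t ≤ r ∧ t ≤ s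

/-- A filter of a poset: a filtered upper set. -/
def OrdFilter (F : Set L) : Prop :=
  DirFiltered F ∧ ∀ r ∈ F, ∀ s : L, r ≤ s → s ∈ F

/-- Every filter has an infimum. -/
def FilteredComplete (L : Type u) [PartialOrder L] : Prop :=
  ∀ F : Set L, OrdFilter F → ∃ i : L, IsGLB F i

/-- `s` is way-above `r`: for every filter `F` with an infimum below `r`, `s ∈ F`. -/
def WayAbove (s r : L) : Prop :=
  ∀ F : Set L, OrdFilter F → ∀ i : L, IsGLB F i → i ≤ r → s ∈ F

/-- The poset is continuous: for every `r`, the set of elements way-above `r`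
is a filter whose infimum is `r`. -/
def ContinuousPoset (L : Type u) [PartialOrder L] : Prop :=
  ∀ r : L, OrdFilter {s : L | WayAbove s r} ∧ IsGLB {s : L | WayAbove s r} r

/-- Conditional completeness: every nonempty set bounded above has a supremum. -/
def CondComplete (L : Type u) [PartialOrder L] : Prop :=
  ∀ S : Set L, S.Nonempty → BddAbove S → ∃ m : L, IsLUB S m

end OrderDefs

/-- A domain: a filtered-complete continuous poset with a least element. -/
def DomainPoset (L : Type u) [PartialOrder L] [OrderBot L] : Prop :=
  FilteredComplete L ∧ ContinuousPoset L

section TopDefs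
variable {E : Type v} [TopologicalSpace E]

/-- The saturation of a set: intersection of all open sets containing it. -/
def satur (A : Set E) : Set E := ⋂₀ {G : Set E | IsOpen G ∧ A ⊆ G}

/-- A set is saturated if it is an intersection of open sets. -/
def IsSatur (A : Set E) : Prop :=
  ∃ 𝒢 : Set (Set E), (∀ G ∈ 𝒢, IsOpen G) ∧ A = ⋂₀ 𝒢

/-- The collection 𝒬 of compact saturated subsets. -/
def CompactSat (E : Type v) [TopologicalSpace E] : Set (Set E) :=
  {A : Set E | IsCompact A ∧ IsSatur A}

/-- The Borel σ-algebra generated by open sets and compact saturated sets. -/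
def BorelM (E : Type v) [TopologicalSpace E] : MeasurableSpace E :=
  MeasurableSpace.generateFrom ({A : Set E | IsOpen A} ∪ CompactSat E)

/-- Borel subsets for the σ-algebra generated by opens and compact saturated sets. -/
def IsBorelSet (B : Set E) : Prop := @MeasurableSet E (BorelM E) B

/-- The collection 𝒦 of compact Borel subsets. -/
def CompactBorel (E : Type v) [TopologicalSpace E] : Set (Set E) :=
  {A : Set E | IsBorelSet A ∧ IsCompact A}

/-- `[x]` : the compact Borel set `↑{x} ∩ closure {x}`. -/
def ptClass (x : E) : Set E := satur {x} ∩ closure {x}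

end TopDefs

section MeasDefs
variable {L : Type u} {E : Type v} [PartialOrder L] [OrderBot L] [TopologicalSpace E]

/-- An L-valued maxitive measure on the Borel σ-algebra. -/
def Maxitive (ν : Set E → L) : Prop :=
  ν ∅ = ⊥ ∧ ∀ 𝒞 : Set (Set E), 𝒞.Finite → (∀ B ∈ 𝒞, IsBorelSet B) →
    IsLUB (ν '' 𝒞) (ν (⋃₀ 𝒞))

/-- σ-maxitivity. -/
def SigmaMaxitive (ν : Set E → L) : Prop :=
  Maxitive ν ∧ ∀ 𝒞 : Set (Set E), 𝒞.Countable → (∀ B ∈ 𝒞, IsBorelSet B) →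
    IsLUB (ν '' 𝒞) (ν (⋃₀ 𝒞))

/-- Complete maxitivity. -/
def CompletelyMaxitive (ν : Set E → L) : Prop :=
  Maxitive ν ∧ ∀ 𝒞 : Set (Set E), (∀ B ∈ 𝒞, IsBorelSet B) → IsBorelSet (⋃₀ 𝒞) →
    IsLUB (ν '' 𝒞) (ν (⋃₀ 𝒞))

/-- The set `{ν G : G open, G ⊇ B}`. -/
def outerVals (ν : Set E → L) (B : Set E) : Set L :=
  {l : L | ∃ G : Set E, IsOpen G ∧ B ⊆ G ∧ ν G = l}

/-- `νp` is the map `ν⁺ : B ↦ inf {ν G : G open, G ⊇ B}` on Borel sets. -/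
def IsNuPlus (ν νp : Set E → L) : Prop :=
  ∀ B : Set E, IsBorelSet B → IsGLB (outerVals ν B) (νp B)

/-- Outer-continuity. -/
def OuterContinuous (ν : Set E → L) : Prop :=
  ∀ B : Set E, IsBorelSet B → IsGLB (outerVals ν B) (ν B)

/-- Inner-continuity. -/
def InnerContinuous (ν : Set E → L) : Prop :=
  ∀ B : Set E, IsBorelSet B →
    IsLUB {l : L | ∃ K : Set E, IsBorelSet K ∧ IsCompact K ∧ K ⊆ B ∧ ν (satur K) = l} (ν B)

/-- Regularity: inner- and outer-continuity. -/
def RegularMeasure (ν : Set E → L) : Prop :=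
  InnerContinuous ν ∧ OuterContinuous ν

/-- Weak outer-continuity: `ν K = ν⁺ K` for every compact Borel `K`. -/
def WeaklyOuterContinuous (ν : Set E → L) : Prop :=
  ∀ K : Set E, IsBorelSet K → IsCompact K → IsGLB (outerVals ν K) (ν K)

/-- Weak inner-continuity (relative to a given `ν⁺ = νp`). -/
def WeaklyInnerContinuous (ν νp : Set E → L) : Prop :=
  ∀ G : Set E, IsOpen G →
    IsLUB {l : L | ∃ K : Set E, IsBorelSet K ∧ IsCompact K ∧ K ⊆ G ∧ νp K = l} (ν G)

/-- 𝒜-smoothness. -/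
def SmoothWrt (ν : Set E → L) (𝒜 : Set (Set E)) : Prop :=
  ∀ 𝒟 : Set (Set E), 𝒟.Nonempty → 𝒟 ⊆ 𝒜 → DirectedOn (· ⊇ ·) 𝒟 →
    IsGLB (ν '' 𝒟) (ν (⋂₀ 𝒟))

/-- Saturation of a maxitive measure: `ν K = ν (↑K)` for compact Borel `K`. -/
def SaturatedMeasure (ν : Set E → L) : Prop :=
  ∀ K : Set E, IsBorelSet K → IsCompact K → ν K = ν (satur K)

/-- Tightness: `inf {ν (E ∖ K) : K compact Borel} = 0`. -/
def TightMeasure (ν : Set E → L) : Prop :=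
  IsGLB {l : L | ∃ K : Set E, IsBorelSet K ∧ IsCompact K ∧ ν Kᶜ = l} (⊥ : L)

/-- `c` is a cardinal density of `ν`. -/
def IsCardinalDensity (ν : Set E → L) (c : E → L) : Prop :=
  ∀ B : Set E, IsBorelSet B → IsLUB (c '' B) (ν B)

/-- Upper semicontinuity of a map into the poset. -/
def UscMap (c : E → L) : Prop := ∀ t : L, IsOpen {x : E | WayAbove t (c x)}

/-- Upper compactness of a map into the poset. -/
def UpperCompactMap (c : E → L) : Prop :=
  ∀ t : L, WayAbove t (⊥ : L) → IsCompact {x : E | ¬ WayAbove t (c x)}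

/-- Continuity from above along decreasing sequences of Borel sets. -/
def ContinuousFromAbove (ν : Set E → L) : Prop :=
  ∀ B : ℕ → Set E, (∀ n, IsBorelSet (B n)) → (∀ n, B (n + 1) ⊆ B n) →
    IsGLB (Set.range fun n => ν (B n)) (ν (⋂ n, B n))

/-- An optimal measure: a σ-maxitive measure continuous from above. -/
def OptimalMeasure (ν : Set E → L) : Prop :=
  SigmaMaxitive ν ∧ ContinuousFromAbove ν

/-- `flo` is the regular part `⌊ν⌋` (relative to `νp = ν⁺`):
`⌊ν⌋(B) = sup {ν⁺(K) : K compact Borel, K ⊆ B}`. -/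
def RegPartRel (νp flo : Set E → L) : Prop :=
  ∀ B : Set E, IsBorelSet B →
    IsLUB {l : L | ∃ K : Set E, IsBorelSet K ∧ IsCompact K ∧ K ⊆ B ∧ νp K = l} (flo B)

end MeasDefs

section Saturation
variable {E : Type v} [TopologicalSpace E]

theorem satur_eq_nhdsKer (A : Set E) : satur A = nhdsKer A := by
  rw [nhdsKer_def]; rfl

theorem subset_satur (A : Set E) : A ⊆ satur A :=
  subset_sInter fun _ hG => hG.2

theorem satur_subset_of_isOpen {A G : Set E} (hG : IsOpen G) (h : A ⊆ G) : satur A ⊆ G :=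
  sInter_subset_of_mem ⟨hG, h⟩

theorem isSatur_satur (A : Set E) : IsSatur (satur A) :=
  ⟨_, fun _ hG => hG.1, rfl⟩

theorem IsCompact.satur_mem_compactSat {K : Set E} (hK : IsCompact K) :
    satur K ∈ CompactSat E :=
  ⟨by rw [satur_eq_nhdsKer]; exact hK.nhdsKer, isSatur_satur K⟩

theorem IsOpen.isBorelSet {G : Set E} (hG : IsOpen G) : IsBorelSet G :=
  MeasurableSpace.measurableSet_generateFrom (Or.inl hG)

theorem isBorelSet_of_mem_compactSat {Q : Set E} (hQ : Q ∈ CompactSat E) : IsBorelSet Q :=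
  MeasurableSpace.measurableSet_generateFrom (Or.inr hQ)

theorem IsBorelSet.compl {B : Set E} (hB : IsBorelSet B) : IsBorelSet Bᶜ :=
  MeasurableSet.compl hB

/-- In a locally compact space, every open neighbourhood of a compact set contains a
compact saturated neighbourhood of it. -/
theorem exists_compactSat_between [LocallyCompactSpace E] {K U : Set E} (hK : IsCompact K)
    (hU : IsOpen U) (h : K ⊆ U) : ∃ Q ∈ CompactSat E, K ⊆ interior Q ∧ Q ⊆ U := by
  obtain ⟨C, hC, hKC, hCU⟩ := exists_compact_between hK hU h
  exact ⟨satur C, hC.satur_mem_compactSat, hKC.trans (interior_mono (subset_satur C)),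
    satur_subset_of_isOpen hU hCU⟩

end Saturation

section Measures
variable {L : Type u} {E : Type v} [PartialOrder L] [OrderBot L] [TopologicalSpace E]

theorem Maxitive.mono {ν : Set E → L} (hν : Maxitive ν) {A B : Set E} (hA : IsBorelSet A)
    (hB : IsBorelSet B) (h : A ⊆ B) : ν A ≤ ν B := by
  have key := hν.2 {A, B} (toFinite _) (by rintro C (rfl | rfl) <;> assumption)
  rw [sUnion_pair, union_eq_self_of_subset_left h] at key
  exact key.1 ⟨A, mem_insert _ _, rfl⟩

theorem tightMeasure_of_closed_smooth [LocallyCompactSpace E] {ν : Set E → L}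
    (hν : Maxitive ν) (hF : SmoothWrt ν {A : Set E | IsClosed A}) : TightMeasure ν := by
  have key := hF ((fun Q => (interior Q)ᶜ) '' CompactSat E)
    ⟨_, mem_image_of_mem _ isCompact_empty.satur_mem_compactSat⟩
    (by rintro _ ⟨Q, -, rfl⟩; exact isOpen_interior.isClosed_compl)
    (by
      rintro _ ⟨Q, hQ, rfl⟩ _ ⟨R, hR, rfl⟩
      refine ⟨_, mem_image_of_mem _ (hQ.1.union hR.1).satur_mem_compactSat, ?_, ?_⟩
      · exact compl_subset_compl.2
          (interior_mono (subset_union_left.trans (subset_satur _)))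
      · exact compl_subset_compl.2
          (interior_mono (subset_union_right.trans (subset_satur _))))
  have hempty : ⋂₀ ((fun Q : Set E => (interior Q)ᶜ) '' CompactSat E) = ∅ := by
    refine eq_empty_of_forall_notMem fun x hx => ?_
    obtain ⟨Q, hQ, hxQ, -⟩ :=
      exists_compactSat_between (isCompact_singleton (x := x)) isOpen_univ (subset_univ _)
    exact hx _ (mem_image_of_mem _ hQ) (hxQ rfl)
  rw [hempty, hν.1] at key
  refine ⟨fun _ _ => bot_le, fun l hl => key.2 ?_⟩
  rintro _ ⟨_, ⟨Q, hQ, rfl⟩, rfl⟩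
  have hQB := isBorelSet_of_mem_compactSat hQ
  exact (hl ⟨Q, hQB, hQ.1, rfl⟩).trans
    (hν.mono hQB.compl isOpen_interior.isBorelSet.compl (compl_subset_compl.2 interior_subset))

theorem weaklyOuterContinuous_of_compactSat_smooth [LocallyCompactSpace E] {ν : Set E → L}
    (hν : Maxitive ν) (hQ : SmoothWrt ν (CompactSat E)) (hsat : SaturatedMeasure ν) :
    WeaklyOuterContinuous ν := by
  intro K hKB hK
  have key := hQ {Q | Q ∈ CompactSat E ∧ K ⊆ interior Q}
    (by
      obtain ⟨Q, hQ, hKQ, -⟩ := exists_compactSat_between hK isOpen_univ (subset_univ _)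
      exact ⟨Q, hQ, hKQ⟩)
    (fun _ h => h.1)
    (by
      rintro Q ⟨-, hKQ⟩ R ⟨-, hKR⟩
      obtain ⟨S, hS, hKS, hSQR⟩ := exists_compactSat_between hK
        (isOpen_interior.inter isOpen_interior) (subset_inter hKQ hKR)
      exact ⟨S, ⟨hS, hKS⟩, hSQR.trans (inter_subset_left.trans interior_subset),
        hSQR.trans (inter_subset_right.trans interior_subset)⟩)
  have hinter : ⋂₀ {Q | Q ∈ CompactSat E ∧ K ⊆ interior Q} = satur K := by
    apply Subset.antisymm
    · rintro x hx G ⟨hG, hKG⟩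
      obtain ⟨Q, hQ, hKQ, hQG⟩ := exists_compactSat_between hK hG hKG
      exact hQG (hx Q ⟨hQ, hKQ⟩)
    · rintro x hx Q ⟨-, hKQ⟩
      exact interior_subset (hx _ ⟨isOpen_interior, hKQ⟩)
  rw [hinter, ← hsat K hKB hK] at key
  constructor
  · rintro _ ⟨G, hG, hKG, rfl⟩
    exact hν.mono hKB hG.isBorelSet hKG
  · refine fun l hl => key.2 ?_
    rintro _ ⟨Q, ⟨hQ, hKQ⟩, rfl⟩
    exact (hl ⟨_, isOpen_interior, hKQ, rfl⟩).trans
      (hν.mono isOpen_interior.isBorelSet (isBorelSet_of_mem_compactSat hQ) interior_subset)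

end Measures

/-- on a locally compact quasisober space, every 𝒬-smooth, 𝓕-smooth,
saturated maxitive measure is tight and weakly outer-continuous. -/
theorem stmt9 {L : Type u} {E : Type v} [PartialOrder L] [OrderBot L]
    [TopologicalSpace E] [QuasiSober E] [LocallyCompactSpace E] (hL : DomainPoset L)
    (ν : Set E → L) (hν : Maxitive ν)
    (hQ : SmoothWrt ν (CompactSat E)) (hF : SmoothWrt ν {A : Set E | IsClosed A})
    (hsat : SaturatedMeasure ν) :
    TightMeasure ν ∧ WeaklyOuterContinuous ν := by
  exact ⟨tightMeasure_of_closed_smooth hν hF,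
    weaklyOuterContinuous_of_compactSat_smooth hν hQ hsat⟩
end

section
/- Let L be a domain, let F be a filter of L, and let t ∈ L be such that, for every f ∈ F, the supremum t ⊔ f exists in L. Then the supremum t ⊔ (inf F) exists and equals the infimum of {t ⊔ f : f ∈ F}. -/
open Set

universe u v

/-- in a domain, if `t ⊔ f` exists for every `f` in a filter `F`
with infimum `i`, then `t ⊔ i` exists and equals `inf {t ⊔ f : f ∈ F}`. -/
theorem stmt17 {L : Type u} [PartialOrder L] [OrderBot L] (hL : DomainPoset L)
    (F : Set L) (hF : OrdFilter F) (t : L)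
    (hsup : ∀ f ∈ F, ∃ m : L, IsLUB {t, f} m)
    (i : L) (hi : IsGLB F i) :
    ∃ j : L, IsLUB {t, i} j ∧ IsGLB {l : L | ∃ f ∈ F, IsLUB {t, f} l} j := by
  have hG : OrdFilter {s : L | ∃ f ∈ F, ∃ l, IsLUB {t, f} l ∧ l ≤ s} := by
    refine ⟨⟨?_, ?_⟩, ?_⟩
    · obtain ⟨f, hf⟩ := hF.1.1
      obtain ⟨m, hm⟩ := hsup f hf
      exact ⟨m, f, hf, m, hm, le_rfl⟩
    · rintro r ⟨f, hf, l, hl, hlr⟩ s ⟨g, hg, k, hk, hks⟩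
      obtain ⟨h, hh, hhf, hhg⟩ := hF.1.2 f hf g hg
      obtain ⟨m, hm⟩ := hsup h hh
      refine ⟨m, ⟨h, hh, m, hm, le_rfl⟩, le_trans (hm.2 ?_) hlr, le_trans (hm.2 ?_) hks⟩
      · rintro x (rfl | rfl)
        · exact hl.1 (by simp)
        · exact hhf.trans (hl.1 (by simp))
      · rintro x (rfl | rfl)
        · exact hk.1 (by simp)
        · exact hhg.trans (hk.1 (by simp))
    · rintro r ⟨f, hf, l, hl, hlr⟩ s hrs
      exact ⟨f, hf, l, hl, hlr.trans hrs⟩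
  obtain ⟨j, hj⟩ := hL.1 _ hG
  refine ⟨j, ⟨?_, fun u hu => ?_⟩, ?_, fun b hb => hj.2 ?_⟩
  · rintro x (rfl | rfl)
    · refine hj.2 ?_
      rintro s ⟨f, hf, l, hl, hls⟩
      exact le_trans (hl.1 (by simp)) hls
    · refine hj.2 ?_
      rintro s ⟨f, hf, l, hl, hls⟩
      exact (hi.1 hf).trans (le_trans (hl.1 (by simp)) hls)
  · have htu : t ≤ u := hu (by simp)
    have hiu : i ≤ u := hu (by simp)
    refine (hL.2 u).2.2 fun s hs => hj.1 ⟨s, hs F hF i hi hiu, s, ⟨?_, fun b hb => hb (by simp)⟩, le_rfl⟩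
    rintro x (rfl | rfl)
    · exact htu.trans ((hL.2 u).2.1 hs)
    · exact le_rfl
  · rintro l ⟨f, hf, hl⟩
    exact hj.1 ⟨f, hf, l, hl, le_rfl⟩
  · rintro s ⟨f, hf, l, hl, hls⟩
    exact le_trans (hb ⟨f, hf, hl⟩) hls
end
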